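/- Let R_j(g,h) = R_j(h^{-1}g) be the kernel of the classical Riesz transform R_j = X_j(−Δ_{H^n})^{-1/2} and R^L_j(g,h) the kernel of R^L_j = X_j L^{-1/2}. For every fixed A > 0 there exists C such that for all h: ∫_{B(h, A ρ(h))} |R^L_j(g,h) − R_j(g,h)| dg ≤ C. -/

import Mathlib

open MeasureTheory Real

/-- The Heisenberg group `ℍⁿ`, identified with `ℝⁿ × ℝⁿ × ℝ`
(so that `x_{n+j}` of the paper is the second factor). -/
abbrev Hn (n : ℕ) := (Fin n → ℝ) × (Fin n → ℝ) × ℝ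

namespace Heisenberg

variable {n : ℕ}

/-- Group multiplication on the Heisenberg group. -/
noncomputable def hmul (g h : Hn n) : Hn n :=
  (g.1 + h.1, g.2.1 + h.2.1,
    g.2.2 + h.2.2 + 2 * ∑ j, (g.2.1 j * h.1 j - g.1 j * h.2.1 j))

/-- Group inverse on the Heisenberg group. -/
def hinv (g : Hn n) : Hn n := (-g.1, -g.2.1, -g.2.2)

/-- The homogeneous norm `|(x,t)| = (|x|⁴ + |t|²)^{1/4}`. -/
noncomputable def hnorm (g : Hn n) : ℝ :=
  ((∑ j, g.1 j ^ 2 + ∑ j, g.2.1 j ^ 2) ^ 2 + g.2.2 ^ 2) ^ ((1 : ℝ) / 4)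

/-- Left-invariant distance `d(g,h) = |g⁻¹ h|`. -/
noncomputable def dist' (g h : Hn n) : ℝ := hnorm (hmul (hinv g) h)

/-- The ball `B(g,r)` for the left-invariant distance. -/
def ball (g : Hn n) (r : ℝ) : Set (Hn n) := {h | dist' g h < r}

/-- The homogeneous dimension `Q = 2n + 2`. -/
noncomputable def Qd (n : ℕ) : ℝ := 2 * n + 2

/-- Anisotropic dilations `δ_r(x,t) = (r x, r² t)`. -/
noncomputable def hdil (r : ℝ) (g : Hn n) : Hn n := (r • g.1, r • g.2.1, r ^ 2 * g.2.2)

/-- The function `ψ(g) = |x|²/|g|²`. -/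
noncomputable def psi (g : Hn n) : ℝ :=
  (∑ j, g.1 j ^ 2 + ∑ j, g.2.1 j ^ 2) / hnorm g ^ 2

/-- The reverse Hölder class `B_q`: `V` is nonnegative, locally `L^q`, and satisfies
`(|B|⁻¹ ∫_B V^q)^{1/q} ≤ C |B|⁻¹ ∫_B V` uniformly over all balls. -/
def RevHolder (n : ℕ) (V : Hn n → ℝ) (q : ℝ) : Prop :=
  (∀ g, 0 ≤ V g) ∧
  (∀ (g : Hn n) (r : ℝ), 0 < r → IntegrableOn (fun h => V h ^ q) (ball g r) volume) ∧
  (∀ (g : Hn n) (r : ℝ), 0 < r → IntegrableOn V (ball g r) volume) ∧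
  ∃ C > 0, ∀ (g : Hn n) (r : ℝ), 0 < r →
    (((volume (ball g r)).toReal)⁻¹ * ∫ h in ball g r, V h ^ q) ^ (1 / q) ≤
      C * (((volume (ball g r)).toReal)⁻¹ * ∫ h in ball g r, V h)

/-- The auxiliary function `ρ(g) = sup { r > 0 : r^{-(Q-2)} ∫_{B(g,r)} V ≤ 1 }`. -/
noncomputable def rho (V : Hn n → ℝ) (g : Hn n) : ℝ :=
  sSup {r : ℝ | 0 < r ∧ r ^ (-(Qd n - 2)) * ∫ h in ball g r, V h ≤ 1}

end Heisenberg

namespace Heisenberg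

section Geometry

variable {n : ℕ}

theorem hnorm_nonneg (g : Hn n) : 0 ≤ hnorm g := by
  unfold hnorm; positivity

theorem hnorm_pow_four (g : Hn n) :
    hnorm g ^ 4 = (∑ j, g.1 j ^ 2 + ∑ j, g.2.1 j ^ 2) ^ 2 + g.2.2 ^ 2 := by
  unfold hnorm
  rw [← Real.rpow_natCast, ← Real.rpow_mul (by positivity)]
  norm_num

theorem hnorm_hinv (g : Hn n) : hnorm (hinv g) = hnorm g := by
  simp [hnorm, hinv]

theorem hmul_hinv_rev (g h : Hn n) : hinv (hmul (hinv g) h) = hmul (hinv h) g := by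
  simp only [hinv, hmul, Prod.mk.injEq]
  refine ⟨by abel, by abel, ?_⟩
  have : ∑ j, ((-g.2.1) j * h.1 j - (-g.1) j * h.2.1 j) =
      -∑ j, ((-h.2.1) j * g.1 j - (-h.1) j * g.2.1 j) := by
    rw [← Finset.sum_neg_distrib]
    refine Finset.sum_congr rfl fun j _ => ?_
    simp only [Pi.neg_apply]; ring
  rw [this]; ring

theorem hmul_hinv_hmul (h g w : Hn n) :
    hmul (hmul (hinv h) g) (hmul (hinv g) w) = hmul (hinv h) w := by
  simp only [hinv, hmul, Prod.mk.injEq]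
  refine ⟨by abel, by abel, ?_⟩
  have : ∑ j, ((-h.2.1) j * w.1 j - (-h.1) j * w.2.1 j) =
      ∑ j, ((-h.2.1) j * g.1 j - (-h.1) j * g.2.1 j) +
      ∑ j, ((-g.2.1) j * w.1 j - (-g.1) j * w.2.1 j) +
      ∑ j, ((-h.2.1 + g.2.1) j * (-g.1 + w.1) j - (-h.1 + g.1) j * (-g.2.1 + w.2.1) j) := by
    rw [← Finset.sum_add_distrib, ← Finset.sum_add_distrib]
    refine Finset.sum_congr rfl fun j _ => ?_
    simp only [Pi.neg_apply, Pi.add_apply]; ring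
  rw [this]; ring

theorem hnorm_hmul_le (g h : Hn n) : hnorm (hmul g h) ≤ 2 * (hnorm g + hnorm h) := by
  have ha := hnorm_nonneg g
  have hb := hnorm_nonneg h
  refine le_of_pow_le_pow_left₀ (n := 4) (by norm_num) (by positivity) ?_
  have hg := hnorm_pow_four g
  have hh := hnorm_pow_four h
  rw [hnorm_pow_four]
  set a := hnorm g
  set b := hnorm h
  have hS0 : 0 ≤ ∑ j, g.1 j ^ 2 + ∑ j, g.2.1 j ^ 2 := by positivity
  have hS0' : 0 ≤ ∑ j, h.1 j ^ 2 + ∑ j, h.2.1 j ^ 2 := by positivity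
  have hX0 : 0 ≤ ∑ j, (hmul g h).1 j ^ 2 + ∑ j, (hmul g h).2.1 j ^ 2 := by positivity
  have hX : ∑ j, (hmul g h).1 j ^ 2 + ∑ j, (hmul g h).2.1 j ^ 2 ≤
      2 * ((∑ j, g.1 j ^ 2 + ∑ j, g.2.1 j ^ 2) + (∑ j, h.1 j ^ 2 + ∑ j, h.2.1 j ^ 2)) := by
    simp only [hmul, ← Finset.sum_add_distrib, Finset.mul_sum]
    refine Finset.sum_le_sum fun j _ => ?_
    simp only [Pi.add_apply]
    nlinarith [sq_nonneg (g.1 j - h.1 j), sq_nonneg (g.2.1 j - h.2.1 j)]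
  have hσ : |2 * ∑ j, (g.2.1 j * h.1 j - g.1 j * h.2.1 j)| ≤
      (∑ j, g.1 j ^ 2 + ∑ j, g.2.1 j ^ 2) + (∑ j, h.1 j ^ 2 + ∑ j, h.2.1 j ^ 2) := by
    rw [Finset.mul_sum]
    refine (Finset.abs_sum_le_sum_abs _ _).trans ?_
    simp only [← Finset.sum_add_distrib]
    refine Finset.sum_le_sum fun j _ => ?_
    rw [abs_le]
    constructor <;>
      nlinarith [sq_nonneg (g.1 j - h.2.1 j), sq_nonneg (g.2.1 j - h.1 j),
        sq_nonneg (g.1 j + h.2.1 j), sq_nonneg (g.2.1 j + h.1 j)]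
  set X := ∑ j, (hmul g h).1 j ^ 2 + ∑ j, (hmul g h).2.1 j ^ 2
  set p := ∑ j, g.1 j ^ 2 + ∑ j, g.2.1 j ^ 2
  set q := ∑ j, h.1 j ^ 2 + ∑ j, h.2.1 j ^ 2
  have hp : p ≤ a ^ 2 := abs_le_of_sq_le_sq' (by nlinarith [sq_nonneg g.2.2]) (by positivity) |>.2
  have hq : q ≤ b ^ 2 := abs_le_of_sq_le_sq' (by nlinarith [sq_nonneg h.2.2]) (by positivity) |>.2
  have ht : |g.2.2| ≤ a ^ 2 := abs_le_of_sq_le_sq (by nlinarith [sq_nonneg p]) (by positivity)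
  have hs : |h.2.2| ≤ b ^ 2 := abs_le_of_sq_le_sq (by nlinarith [sq_nonneg q]) (by positivity)
  have hT : |(hmul g h).2.2| ≤ 2 * (a ^ 2 + b ^ 2) := by
    simp only [hmul]
    refine (abs_add_le _ _).trans ?_
    have := abs_add_le g.2.2 h.2.2
    linarith
  have h1 : X ^ 2 ≤ (2 * (a ^ 2 + b ^ 2)) ^ 2 := by gcongr; linarith
  have h2 : (hmul g h).2.2 ^ 2 ≤ (2 * (a ^ 2 + b ^ 2)) ^ 2 := by
    rw [← sq_abs]; gcongr
  have h3 : a ^ 2 + b ^ 2 ≤ (a + b) ^ 2 := by nlinarith [mul_nonneg ha hb]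
  have h4 : (a ^ 2 + b ^ 2) ^ 2 ≤ ((a + b) ^ 2) ^ 2 := by gcongr
  nlinarith [sq_nonneg ((a + b) ^ 2)]

theorem dist'_nonneg (g h : Hn n) : 0 ≤ dist' g h := hnorm_nonneg _

theorem dist'_comm (g h : Hn n) : dist' g h = dist' h g := by
  rw [dist', dist', ← hmul_hinv_rev, hnorm_hinv]

/-- Quasi-triangle inequality for the left-invariant distance. -/
theorem dist'_le (h g w : Hn n) : dist' h w ≤ 2 * (dist' h g + dist' g w) := by
  rw [dist', ← hmul_hinv_hmul h g w]
  exact hnorm_hmul_le _ _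

theorem continuous_hnorm : Continuous (hnorm : Hn n → ℝ) := by
  unfold hnorm
  exact Continuous.rpow_const (by fun_prop) fun _ => Or.inr (by norm_num)

theorem continuous_dist' : Continuous fun p : Hn n × Hn n => dist' p.1 p.2 := by
  unfold dist'
  refine continuous_hnorm.comp ?_
  unfold hmul hinv
  fun_prop

theorem continuous_dist'_left (h : Hn n) : Continuous fun w => dist' h w := by
  have hc : Continuous (hmul (hinv h)) := by
    unfold hmul; fun_prop
  exact continuous_hnorm.comp hc

theorem measurableSet_ball (g : Hn n) (r : ℝ) : MeasurableSet (ball g r) :=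
  (isOpen_lt (continuous_dist'_left g) continuous_const).measurableSet

theorem ball_subset_ball (g : Hn n) {r s : ℝ} (h : r ≤ s) : ball g r ⊆ ball g s :=
  fun _ hw => lt_of_lt_of_le hw h

end Geometry

section Volume

variable {n : ℕ}

theorem hnorm_hdil {r : ℝ} (hr : 0 ≤ r) (g : Hn n) : hnorm (hdil r g) = r * hnorm g := by
  refine (pow_left_inj₀ (hnorm_nonneg _) (mul_nonneg hr (hnorm_nonneg _)) four_ne_zero).1 ?_
  rw [mul_pow, hnorm_pow_four, hnorm_pow_four]
  simp only [hdil, Pi.smul_apply, smul_eq_mul, mul_pow, ← Finset.mul_sum]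
  ring

/-- Lebesgue measure is invariant under left translations. -/
theorem measurePreserving_hmul (g : Hn n) : MeasurePreserving (hmul g) := by
  have key : MeasurePreserving (fun p : (Fin n → ℝ) × ((Fin n → ℝ) × ℝ) =>
      (g.1 + p.1, (g.2.1 + p.2.1, (g.2.2 + 2 * ∑ j, (g.2.1 j * p.1 j - g.1 j * p.2.1 j)) + p.2.2)))
      volume volume := by
    refine MeasurePreserving.skew_product (f := fun x : Fin n → ℝ => g.1 + x)
      (g := fun (x : Fin n → ℝ) (p : (Fin n → ℝ) × ℝ) =>
        (g.2.1 + p.1, (g.2.2 + 2 * ∑ j, (g.2.1 j * x j - g.1 j * p.1 j)) + p.2))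
      (measurePreserving_add_left _ _) (by unfold Function.uncurry; fun_prop)
      (Filter.Eventually.of_forall fun x => ?_)
    refine (MeasurePreserving.skew_product (f := fun y : Fin n → ℝ => g.2.1 + y)
      (g := fun (y : Fin n → ℝ) (t : ℝ) =>
        (g.2.2 + 2 * ∑ j, (g.2.1 j * x j - g.1 j * y j)) + t)
      (measurePreserving_add_left _ _) (by unfold Function.uncurry; fun_prop)
      (Filter.Eventually.of_forall fun y => ?_)).map_eq
    exact (measurePreserving_add_left _ _).map_eq
  have hfun : hmul g = fun p : (Fin n → ℝ) × ((Fin n → ℝ) × ℝ) =>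
      (g.1 + p.1, (g.2.1 + p.2.1,
        (g.2.2 + 2 * ∑ j, (g.2.1 j * p.1 j - g.1 j * p.2.1 j)) + p.2.2)) := by
    funext p
    simp only [hmul]
    rw [add_right_comm]
  rw [hfun]
  exact key

theorem volume_hnorm_lt_ne_top : volume {w : Hn n | hnorm w < 1} ≠ ⊤ := by
  refine ne_top_of_le_ne_top (isCompact_closedBall (0 : Hn n) 1).measure_lt_top.ne
    (measure_mono fun w hw => ?_)
  have h4 : hnorm w ^ 4 ≤ 1 := pow_le_one₀ (hnorm_nonneg w) (le_of_lt hw)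
  rw [hnorm_pow_four] at h4
  have hx : ∑ j, w.1 j ^ 2 + ∑ j, w.2.1 j ^ 2 ≤ 1 := by
    nlinarith [sq_nonneg w.2.2]
  have hx1 : 0 ≤ ∑ j, w.1 j ^ 2 := by positivity
  have hx2 : 0 ≤ ∑ j, w.2.1 j ^ 2 := by positivity
  simp only [Metric.mem_closedBall, dist_zero_right, Prod.norm_def, sup_le_iff,
    pi_norm_le_iff_of_nonneg zero_le_one, Real.norm_eq_abs]
  refine ⟨fun i => ?_, fun i => ?_, ?_⟩
  · rw [← sq_le_one_iff_abs_le_one]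
    have := Finset.single_le_sum (f := fun j => w.1 j ^ 2) (fun j _ => sq_nonneg _)
      (Finset.mem_univ i)
    linarith
  · rw [← sq_le_one_iff_abs_le_one]
    have := Finset.single_le_sum (f := fun j => w.2.1 j ^ 2) (fun j _ => sq_nonneg _)
      (Finset.mem_univ i)
    linarith
  · rw [← sq_le_one_iff_abs_le_one]
    nlinarith [sq_nonneg (∑ j, w.1 j ^ 2 + ∑ j, w.2.1 j ^ 2)]

theorem volume_hnorm_lt_ne_zero : volume {w : Hn n | hnorm w < 1} ≠ 0 := by
  refine (isOpen_lt continuous_hnorm continuous_const).measure_ne_zero _ ⟨0, ?_⟩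
  simp [hnorm]

instance isAddHaarMeasure_volume : (volume : Measure (Hn n)).IsAddHaarMeasure :=
  haveI : (volume : Measure ((Fin n → ℝ) × ℝ)).IsAddHaarMeasure :=
    Measure.prod.instIsAddHaarMeasure (volume : Measure (Fin n → ℝ)) (volume : Measure ℝ)
  Measure.prod.instIsAddHaarMeasure (volume : Measure (Fin n → ℝ))
    (volume : Measure ((Fin n → ℝ) × ℝ))

theorem volume_preimage_hdil {r : ℝ} (hr : 0 < r) (s : Set (Hn n)) :
    volume (hdil r ⁻¹' s) = ENNReal.ofReal (r ^ (-Qd n)) * volume s := by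
  let f : Hn n →ₗ[ℝ] Hn n := (LinearMap.lsmul ℝ (Fin n → ℝ) r).prodMap
    ((LinearMap.lsmul ℝ (Fin n → ℝ) r).prodMap (LinearMap.lsmul ℝ ℝ (r ^ 2)))
  have hf : (hdil r : Hn n → Hn n) = f := rfl
  have hdet : LinearMap.det f = r ^ n * (r ^ n * r ^ 2) := by
    have h1 : LinearMap.det (LinearMap.lsmul ℝ (Fin n → ℝ) r) = r ^ n := by
      have : LinearMap.lsmul ℝ (Fin n → ℝ) r = r • LinearMap.id := by ext; simp
      rw [this, LinearMap.det_smul]; simp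
    have h2 : LinearMap.det (LinearMap.lsmul ℝ ℝ (r ^ 2)) = r ^ 2 := by
      have : LinearMap.lsmul ℝ ℝ (r ^ 2) = r ^ 2 • LinearMap.id := by ext; simp
      rw [this, LinearMap.det_smul]; simp
    simp only [f, LinearMap.det_prodMap, h1, h2]
  rw [hf, Measure.addHaar_preimage_linearMap _ (by rw [hdet]; positivity), hdet]
  congr 2
  rw [abs_of_nonneg (by positivity), Real.rpow_neg hr.le, Qd]
  congr 1
  rw [← pow_add, ← pow_add, ← Real.rpow_natCast]
  congr 1
  push_cast; ring

theorem volume_ball (g : Hn n) {r : ℝ} (hr : 0 < r) :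
    volume (ball g r) = ENNReal.ofReal (r ^ Qd n) * volume {w : Hn n | hnorm w < 1} := by
  have h1 : ball g r = hmul (hinv g) ⁻¹' (hdil r⁻¹ ⁻¹' {w : Hn n | hnorm w < 1}) := by
    ext w
    simp only [ball, dist', Set.mem_ofPred_eq, Set.mem_preimage,
      hnorm_hdil (inv_nonneg.2 hr.le), inv_mul_lt_iff₀ hr, mul_one]
  have hm : MeasurableSet (hdil r⁻¹ ⁻¹' {w : Hn n | hnorm w < 1}) := by
    have hc : Continuous (hdil r⁻¹ : Hn n → Hn n) := by
      unfold hdil; fun_prop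
    exact ((isOpen_lt continuous_hnorm continuous_const).preimage hc).measurableSet
  rw [h1, (measurePreserving_hmul _).measure_preimage hm.nullMeasurableSet,
    volume_preimage_hdil (inv_pos.2 hr), Real.inv_rpow hr.le, Real.rpow_neg hr.le, inv_inv]

theorem exists_volume_ball (n : ℕ) : ∃ v > 0, ∀ (g : Hn n) (r : ℝ), 0 < r →
    volume (ball g r) = ENNReal.ofReal (v * r ^ Qd n) := by
  refine ⟨(volume {w : Hn n | hnorm w < 1}).toReal,
    ENNReal.toReal_pos volume_hnorm_lt_ne_zero volume_hnorm_lt_ne_top, fun g r hr => ?_⟩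
  rw [volume_ball g hr, ENNReal.ofReal_mul ENNReal.toReal_nonneg,
    ENNReal.ofReal_toReal volume_hnorm_lt_ne_top, mul_comm]

end Volume

section Dyadic

/-- The constant in `setLIntegral_rpow_neg_le`. -/
noncomputable def dyadicConst (a b : ℝ) : ℝ := 2 ^ b * (1 - 2 ^ (b - a))⁻¹

theorem dyadicConst_pos {a b : ℝ} (hab : b < a) : 0 < dyadicConst a b := by
  have : (2 : ℝ) ^ (b - a) < 1 := Real.rpow_lt_one_of_one_lt_of_neg (by norm_num) (by linarith)
  unfold dyadicConst
  have : 0 < 1 - (2 : ℝ) ^ (b - a) := by linarith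
  positivity

/-- If the sublevel sets of `f` satisfy `μ {f < s} ≤ M s ^ a` for `s ≤ S`, then `f ^ (-b)` is
integrable over `{f < S}` for `0 ≤ b < a`, with integral `O (M S ^ (a - b))`. -/
theorem setLIntegral_rpow_neg_le {α : Type*} [MeasurableSpace α] {μ : Measure α} {f : α → ℝ}
    (hf : Measurable f) (hf0 : ∀ x, 0 ≤ f x) {a b M S : ℝ} (hb : 0 ≤ b) (hab : b < a)
    (hM : 0 ≤ M) (hS : 0 < S)
    (hμ : ∀ s, 0 < s → s ≤ S → μ {x | f x < s} ≤ ENNReal.ofReal (M * s ^ a)) :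
    ∫⁻ x in {x | f x < S}, ENNReal.ofReal (f x ^ (-b)) ∂μ ≤
      ENNReal.ofReal (dyadicConst a b * M * S ^ (a - b)) := by
  have ha : 0 < a := hb.trans_lt hab
  have hS2 : ∀ k : ℕ, 0 < S / 2 ^ k := fun k => by positivity
  have hS2' : ∀ k : ℕ, S / 2 ^ k ≤ S := fun k => div_le_self hS.le (one_le_pow₀ (by norm_num))
  have hlim : Filter.Tendsto (fun k : ℕ => S / 2 ^ k) Filter.atTop (nhds 0) := by
    have := (tendsto_pow_atTop_nhds_zero_of_lt_one (r := (1 / 2 : ℝ)) (by norm_num)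
      (by norm_num)).const_mul S
    simpa [div_eq_mul_inv] using this
  have hzero : μ {x | f x = 0} = 0 := by
    have hl : Filter.Tendsto (fun k : ℕ => ENNReal.ofReal (M * (S / 2 ^ k) ^ a)) Filter.atTop
        (nhds 0) := by
      have := ENNReal.tendsto_ofReal ((hlim.rpow_const (p := a) (Or.inr ha.le)).const_mul M)
      simpa [Real.zero_rpow ha.ne'] using this
    refine le_antisymm (ge_of_tendsto' hl fun k => ?_) (zero_le)
    refine (measure_mono fun x hx => ?_).trans (hμ _ (hS2 k) (hS2' k))
    have hx' : f x = 0 := hx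
    show f x < _
    rw [hx']; exact hS2 k
  let T : ℕ → Set α := fun k => {x | S / 2 ^ (k + 1) ≤ f x ∧ f x < S / 2 ^ k}
  have hT : ∀ k, MeasurableSet (T k) := fun k =>
    (measurableSet_le measurable_const hf).inter (measurableSet_lt hf measurable_const)
  have hcover : {x | f x < S} ⊆ {x | f x = 0} ∪ ⋃ k, T k := by
    intro x hx
    have hx : f x < S := hx
    rcases (hf0 x).eq_or_lt with h0 | h0
    · exact Or.inl h0.symm
    · right
      have hex : ∃ k : ℕ, S / 2 ^ k ≤ f x :=
        ((hlim.eventually (gt_mem_nhds h0)).exists).imp fun _ => le_of_lt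
      classical
      obtain ⟨m, hm⟩ : ∃ m, Nat.find hex = m + 1 := by
        refine Nat.exists_eq_succ_of_ne_zero fun h => ?_
        have := Nat.find_spec hex
        rw [h] at this
        simp at this
        linarith
      refine Set.mem_iUnion.2 ⟨m, ?_, ?_⟩
      · rw [← hm]; exact Nat.find_spec hex
      · exact not_le.1 (Nat.find_min hex (by omega))
  set y : ℝ := 2 ^ (b - a) with hy
  have hy0 : 0 < y := by positivity
  have hy1 : y < 1 := Real.rpow_lt_one_of_one_lt_of_neg (by norm_num) (by linarith)
  have hterm : ∀ k, ∫⁻ x in T k, ENNReal.ofReal (f x ^ (-b)) ∂μ ≤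
      ENNReal.ofReal (2 ^ b * M * S ^ (a - b) * y ^ k) := by
    intro k
    calc ∫⁻ x in T k, ENNReal.ofReal (f x ^ (-b)) ∂μ
        ≤ ∫⁻ _ in T k, ENNReal.ofReal ((S / 2 ^ (k + 1)) ^ (-b)) ∂μ := by
          refine setLIntegral_mono' (hT k) fun x hx => ENNReal.ofReal_le_ofReal ?_
          exact Real.rpow_le_rpow_of_nonpos (hS2 _) hx.1 (by linarith)
      _ = ENNReal.ofReal ((S / 2 ^ (k + 1)) ^ (-b)) * μ (T k) := by
          rw [setLIntegral_const]
      _ ≤ ENNReal.ofReal ((S / 2 ^ (k + 1)) ^ (-b)) * ENNReal.ofReal (M * (S / 2 ^ k) ^ a) := by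
          gcongr
          exact (measure_mono fun x hx => hx.2).trans (hμ _ (hS2 k) (hS2' k))
      _ = ENNReal.ofReal (2 ^ b * M * S ^ (a - b) * y ^ k) := by
          rw [← ENNReal.ofReal_mul (by positivity)]
          congr 1
          have e1 : S / 2 ^ (k + 1) = (S / 2 ^ k) * 2⁻¹ := by
            rw [pow_succ]; field_simp
          have e2 : y ^ k = ((2 : ℝ) ^ k) ^ (b - a) := by
            rw [hy, ← Real.rpow_natCast, ← Real.rpow_natCast, ← Real.rpow_mul (by norm_num),
              ← Real.rpow_mul (by norm_num), mul_comm]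
          have e3 : (S / 2 ^ k) ^ (a - b) = S ^ (a - b) * y ^ k := by
            rw [e2, Real.div_rpow hS.le (by positivity), ← neg_sub a b,
              Real.rpow_neg (by positivity), div_eq_mul_inv]
          have e4 : (S / 2 ^ k) ^ (-b) * (S / 2 ^ k) ^ a = (S / 2 ^ k) ^ (a - b) := by
            rw [← Real.rpow_add (hS2 k)]; congr 1; ring
          have e5 : (2⁻¹ : ℝ) ^ (-b) = 2 ^ b := by
            rw [Real.inv_rpow (by norm_num), Real.rpow_neg (by norm_num), inv_inv]
          rw [e1, Real.mul_rpow (hS2 k).le (by norm_num), e5, mul_assoc (2 ^ b * M), ← e3, ← e4]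
          ring
  calc ∫⁻ x in {x | f x < S}, ENNReal.ofReal (f x ^ (-b)) ∂μ
      ≤ ∫⁻ x in {x | f x = 0} ∪ ⋃ k, T k, ENNReal.ofReal (f x ^ (-b)) ∂μ :=
        lintegral_mono_set hcover
    _ ≤ ∫⁻ x in {x | f x = 0}, ENNReal.ofReal (f x ^ (-b)) ∂μ +
          ∫⁻ x in ⋃ k, T k, ENNReal.ofReal (f x ^ (-b)) ∂μ := lintegral_union_le _ _ _
    _ = ∫⁻ x in ⋃ k, T k, ENNReal.ofReal (f x ^ (-b)) ∂μ := by
        rw [setLIntegral_measure_zero _ _ hzero, zero_add]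
    _ ≤ ∑' k, ∫⁻ x in T k, ENNReal.ofReal (f x ^ (-b)) ∂μ := lintegral_iUnion_le _ _
    _ ≤ ∑' k, ENNReal.ofReal (2 ^ b * M * S ^ (a - b) * y ^ k) := ENNReal.tsum_le_tsum hterm
    _ = ENNReal.ofReal (∑' k, 2 ^ b * M * S ^ (a - b) * y ^ k) := by
        rw [ENNReal.ofReal_tsum_of_nonneg (fun k => by positivity)
          ((summable_geometric_of_lt_one hy0.le hy1).mul_left _)]
    _ = ENNReal.ofReal (dyadicConst a b * M * S ^ (a - b)) := by
        rw [tsum_mul_left, tsum_geometric_of_lt_one hy0.le hy1, dyadicConst]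
        congr 1; ring

end Dyadic

section ReverseHolder

variable {n : ℕ}

theorem two_le_Qd (n : ℕ) : 2 ≤ Qd n := by
  unfold Qd
  have : (0 : ℝ) ≤ n := Nat.cast_nonneg n
  linarith

/-- A reverse Hölder weight is an `A_∞` weight. -/
theorem RevHolder.setIntegral_le {V : Hn n → ℝ} {q : ℝ} (hq : 1 < q) (hV : RevHolder n V q) :
    ∃ C > 0, ∀ (g : Hn n) (r : ℝ), 0 < r → ∀ E ⊆ ball g r, MeasurableSet E →
      ∫ w in E, V w ≤ C * ((volume E).toReal / (volume (ball g r)).toReal) ^ (1 - 1 / q) *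
        ∫ w in ball g r, V w := by
  obtain ⟨hV0, hVq, hV1, C, hC, hRH⟩ := hV
  obtain ⟨v, hv, hvol⟩ := exists_volume_ball n
  refine ⟨C, hC, fun g r hr E hE hEm => ?_⟩
  have hq0 : 0 < q := by linarith
  have hBtop : volume (ball g r) ≠ ⊤ := by rw [hvol g r hr]; exact ENNReal.ofReal_ne_top
  have hB : 0 < (volume (ball g r)).toReal := by
    rw [hvol g r hr, ENNReal.toReal_ofReal (by positivity)]; positivity
  have hEtop : volume E ≠ ⊤ := ne_top_of_le_ne_top hBtop (measure_mono hE)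
  have : IsFiniteMeasure (volume.restrict E) := ⟨by simpa using hEtop.lt_top⟩
  have hpq : q.HolderConjugate (Real.conjExponent q) := Real.HolderConjugate.conjExponent hq
  have hmem : MemLp V (ENNReal.ofReal q) (volume.restrict E) := by
    have hm : AEStronglyMeasurable V (volume.restrict E) :=
      ((hV1 g r hr).mono_set hE).aestronglyMeasurable
    rw [← integrable_norm_rpow_iff hm (by simpa using hq0) ENNReal.ofReal_ne_top,
      ENNReal.toReal_ofReal hq0.le]
    refine ((hVq g r hr).mono_set hE).congr (Filter.Eventually.of_forall fun x => ?_)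
    simp only [Real.norm_of_nonneg (hV0 x)]
  have hconj : 1 / Real.conjExponent q = 1 - 1 / q := by
    have := hpq.inv_add_inv_eq_one
    rw [one_div, one_div]; linarith
  have hH := integral_mul_le_Lp_mul_Lq_of_nonneg (μ := volume.restrict E) hpq
    (f := V) (g := fun _ => (1 : ℝ)) (Filter.Eventually.of_forall hV0)
    (Filter.Eventually.of_forall fun _ => zero_le_one) hmem (memLp_const 1)
  simp only [mul_one, Real.one_rpow, hconj] at hH
  rw [setIntegral_const, smul_eq_mul, mul_one, Measure.real] at hH
  have hmono : ∫ w in E, V w ^ q ≤ ∫ w in ball g r, V w ^ q :=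
    setIntegral_mono_set (hVq g r hr)
      (Filter.Eventually.of_forall fun w => Real.rpow_nonneg (hV0 w) q) hE.eventuallyLE
  have hEq0 : 0 ≤ ∫ w in E, V w ^ q := integral_nonneg fun w => Real.rpow_nonneg (hV0 w) q
  have hBq0 : 0 ≤ ∫ w in ball g r, V w ^ q := integral_nonneg fun w => Real.rpow_nonneg (hV0 w) q
  have h1 := hRH g r hr
  set b := (volume (ball g r)).toReal
  set e := (volume E).toReal
  have he : 0 ≤ e := ENNReal.toReal_nonneg
  rw [Real.mul_rpow (by positivity) hBq0] at h1
  have h2 : (∫ w in ball g r, V w ^ q) ^ (1 / q) ≤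
      C * (b ^ (1 / q - 1) * ∫ w in ball g r, V w) := by
    have hbq : b⁻¹ ^ (1 / q) * b ^ (1 / q) = 1 := by
      rw [← Real.mul_rpow (by positivity) hB.le, inv_mul_cancel₀ hB.ne', Real.one_rpow]
    calc (∫ w in ball g r, V w ^ q) ^ (1 / q)
        = b ^ (1 / q) * (b⁻¹ ^ (1 / q) * (∫ w in ball g r, V w ^ q) ^ (1 / q)) := by
          rw [← mul_assoc, mul_comm (b ^ (1 / q)), hbq, one_mul]
      _ ≤ b ^ (1 / q) * (C * (b⁻¹ * ∫ w in ball g r, V w)) := by gcongr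
      _ = C * (b ^ (1 / q - 1) * ∫ w in ball g r, V w) := by
          rw [Real.rpow_sub_one hB.ne']; ring
  calc ∫ w in E, V w ≤ (∫ w in E, V w ^ q) ^ (1 / q) * e ^ (1 - 1 / q) := hH
    _ ≤ (C * (b ^ (1 / q - 1) * ∫ w in ball g r, V w)) * e ^ (1 - 1 / q) := by
        gcongr
        exact (Real.rpow_le_rpow hEq0 hmono (by positivity)).trans h2
    _ = C * (e / b) ^ (1 - 1 / q) * ∫ w in ball g r, V w := by
        rw [Real.div_rpow he hB.le, ← neg_sub 1 (1 / q), Real.rpow_neg hB.le, div_eq_mul_inv]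
        ring

/-- Balls of comparable radii have comparable mass for a reverse Hölder weight. -/
theorem RevHolder.exists_setIntegral_ball_le_two_mul {V : Hn n → ℝ} {q : ℝ} (hq : 1 < q)
    (hV : RevHolder n V q) :
    ∃ l > 1, ∀ (g : Hn n) (r : ℝ), 0 < r →
      ∫ w in ball g (l * r), V w ≤ 2 * ∫ w in ball g r, V w := by
  obtain ⟨C, hC, hE⟩ := hV.setIntegral_le hq
  obtain ⟨v, hv, hvol⟩ := exists_volume_ball n
  have hp : 0 < 1 - 1 / q := by
    rw [sub_pos, div_lt_one (by linarith)]; exact hq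
  have hcont : ContinuousAt (fun l : ℝ => C * (1 - l ^ (-Qd n)) ^ (1 - 1 / q)) 1 := by
    refine continuousAt_const.mul (ContinuousAt.rpow_const ?_ (Or.inr hp.le))
    exact continuousAt_const.sub (ContinuousAt.rpow_const continuousAt_id (Or.inl one_ne_zero))
  have hlt : ∀ᶠ l in nhdsWithin (1 : ℝ) (Set.Ioi 1),
      C * (1 - l ^ (-Qd n)) ^ (1 - 1 / q) < 1 / 2 := by
    refine (hcont.eventually_lt continuousAt_const ?_).filter_mono nhdsWithin_le_nhds
    simp only [Real.one_rpow, sub_self, Real.zero_rpow hp.ne']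
    norm_num
  obtain ⟨l, hl, hl1⟩ := (hlt.and self_mem_nhdsWithin).exists
  have hl1 : 1 < l := hl1
  refine ⟨l, hl1, fun g r hr => ?_⟩
  have hlr : 0 < l * r := by positivity
  have hsub : ball g r ⊆ ball g (l * r) := ball_subset_ball g (by nlinarith)
  have hratio : (volume (ball g (l * r) \ ball g r)).toReal / (volume (ball g (l * r))).toReal =
      1 - l ^ (-Qd n) := by
    rw [measure_sdiff hsub (measurableSet_ball g r).nullMeasurableSet
      (by rw [hvol g r hr]; exact ENNReal.ofReal_ne_top),
      ENNReal.toReal_sub_of_le (measure_mono hsub)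
      (by rw [hvol g _ hlr]; exact ENNReal.ofReal_ne_top), hvol g r hr, hvol g _ hlr,
      ENNReal.toReal_ofReal (by positivity), ENNReal.toReal_ofReal (by positivity),
      Real.mul_rpow (by positivity) hr.le, Real.rpow_neg (by positivity)]
    have h1 : 0 < l ^ Qd n := by positivity
    have h2 : 0 < r ^ Qd n := by positivity
    field_simp
  have h1 := hE g (l * r) hlr (ball g (l * r) \ ball g r) Set.sdiff_subset
    ((measurableSet_ball _ _).diff (measurableSet_ball _ _))
  rw [hratio] at h1
  have hint := hV.2.2.1 g (l * r) hlr
  have h2 := setIntegral_sdiff (measurableSet_ball g r) hint hsub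
  have h3 : 0 ≤ ∫ w in ball g (l * r), V w := integral_nonneg hV.1
  nlinarith

/-- Doubling of a reverse Hölder weight. -/
theorem RevHolder.exists_setIntegral_ball_le {V : Hn n → ℝ} {q : ℝ} (hq : 1 < q)
    (hV : RevHolder n V q) (a : ℝ) :
    ∃ C > 0, ∀ (g : Hn n) (r : ℝ), 0 < r →
      ∫ w in ball g (a * r), V w ≤ C * ∫ w in ball g r, V w := by
  obtain ⟨l, hl, h⟩ := hV.exists_setIntegral_ball_le_two_mul hq
  have hpow : ∀ (N : ℕ) (g : Hn n) (r : ℝ), 0 < r →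
      ∫ w in ball g (l ^ N * r), V w ≤ 2 ^ N * ∫ w in ball g r, V w := by
    intro N g r hr
    induction N with
    | zero => simp
    | succ N ih =>
      have := h g (l ^ N * r) (by positivity)
      rw [← mul_assoc, ← pow_succ'] at this
      calc _ ≤ _ := this
        _ ≤ 2 * (2 ^ N * ∫ w in ball g r, V w) := by gcongr
        _ = _ := by rw [pow_succ]; ring
  obtain ⟨N, hN⟩ := pow_unbounded_of_one_lt a hl
  refine ⟨2 ^ N, by positivity, fun g r hr => le_trans ?_ (hpow N g r hr)⟩
  exact setIntegral_mono_set (hV.2.2.1 g _ (by positivity))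
    (Filter.Eventually.of_forall hV.1) (ball_subset_ball g (by gcongr)).eventuallyLE

/-- Growth of the mass of small balls, in terms of the auxiliary function `rho`. -/
theorem RevHolder.exists_setIntegral_ball_le_rho {V : Hn n → ℝ} {q : ℝ} (hq : 1 < q)
    (hV : RevHolder n V q) {a : ℝ} (ha : 0 < a) :
    ∃ C > 0, ∀ (h : Hn n), 0 < rho V h → ∀ s, 0 < s → s ≤ a * rho V h →
      ∫ w in ball h s, V w ≤
        C * (a * rho V h) ^ (Qd n / q - 2) * s ^ (Qd n - Qd n / q) := by
  obtain ⟨C, hC, hE⟩ := hV.setIntegral_le hq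
  obtain ⟨K, hK, hdouble⟩ := hV.exists_setIntegral_ball_le hq (2 * a)
  obtain ⟨v, hv, hvol⟩ := exists_volume_ball n
  have hQ := two_le_Qd n
  refine ⟨C * K * a ^ (-(Qd n - 2)), by positivity, fun h hρ s hs hsa => ?_⟩
  set R := rho V h with hR
  have hS : 0 < a * R := by positivity
  have hmass : ∫ w in ball h (a * R), V w ≤ K * R ^ (Qd n - 2) := by
    set T := {r : ℝ | 0 < r ∧ r ^ (-(Qd n - 2)) * ∫ w in ball h r, V w ≤ 1} with hT
    have hRT : R = sSup T := rfl
    have hne : T.Nonempty := by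
      by_contra hne
      rw [Set.not_nonempty_iff_eq_empty] at hne
      rw [hRT, hne, Real.sSup_empty] at hρ
      exact lt_irrefl _ hρ
    have hbdd : BddAbove T := by
      by_contra hb
      rw [hRT, Real.sSup_of_not_bddAbove hb] at hρ
      exact lt_irrefl _ hρ
    obtain ⟨t, htT, ht⟩ := exists_lt_of_lt_csSup hne (show R / 2 < sSup T by rw [← hRT]; linarith)
    have htR : t ≤ R := le_csSup hbdd htT
    have ht0 : 0 < t := htT.1
    have htV : ∫ w in ball h t, V w ≤ t ^ (Qd n - 2) := by
      have := htT.2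
      rwa [Real.rpow_neg ht0.le, inv_mul_le_iff₀ (by positivity), mul_one] at this
    calc ∫ w in ball h (a * R), V w ≤ ∫ w in ball h (2 * a * t), V w :=
          setIntegral_mono_set (hV.2.2.1 h _ (by positivity))
            (Filter.Eventually.of_forall hV.1) (ball_subset_ball h (by nlinarith)).eventuallyLE
      _ ≤ K * ∫ w in ball h t, V w := hdouble h t ht0
      _ ≤ K * R ^ (Qd n - 2) := by
          gcongr
          exact htV.trans (Real.rpow_le_rpow ht0.le htR (by linarith))
  have h1 := hE h (a * R) hS (ball h s) (ball_subset_ball h hsa) (measurableSet_ball h s)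
  rw [hvol h s hs, hvol h _ hS, ENNReal.toReal_ofReal (by positivity),
    ENNReal.toReal_ofReal (by positivity), mul_div_mul_left _ _ hv.ne',
    ← Real.div_rpow hs.le hS.le, ← Real.rpow_mul (by positivity)] at h1
  have hexp : Qd n * (1 - 1 / q) = Qd n - Qd n / q := by ring
  rw [hexp, Real.div_rpow hs.le hS.le] at h1
  refine h1.trans ?_
  calc C * (s ^ (Qd n - Qd n / q) / (a * R) ^ (Qd n - Qd n / q)) * ∫ w in ball h (a * R), V w
      ≤ C * (s ^ (Qd n - Qd n / q) / (a * R) ^ (Qd n - Qd n / q)) * (K * R ^ (Qd n - 2)) := by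
        gcongr
    _ = C * K * a ^ (-(Qd n - 2)) * (a * R) ^ (Qd n / q - 2) * s ^ (Qd n - Qd n / q) := by
        have e1 : R ^ (Qd n - 2) = a ^ (-(Qd n - 2)) * (a * R) ^ (Qd n - 2) := by
          rw [Real.mul_rpow ha.le hρ.le, ← mul_assoc, ← Real.rpow_add ha]; simp
        have e2 : (a * R) ^ (Qd n / q - 2) =
            (a * R) ^ (Qd n - 2) / (a * R) ^ (Qd n - Qd n / q) := by
          rw [← Real.rpow_sub hS]; congr 1; ring
        rw [e1, e2]; ring

end ReverseHolder

section Potential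

variable {n : ℕ}

theorem RevHolder.aemeasurable {V : Hn n → ℝ} {q : ℝ} (hV : RevHolder n V q) :
    AEMeasurable V := by
  have hU : ⋃ k : ℕ, ball (0 : Hn n) (k + 1) = Set.univ := by
    refine Set.eq_univ_of_forall fun w => Set.mem_iUnion.2 ?_
    obtain ⟨k, hk⟩ := exists_nat_gt (dist' 0 w)
    exact ⟨k, show dist' 0 w < k + 1 by linarith⟩
  rw [← Measure.restrict_univ (μ := (volume : Measure (Hn n))), ← hU, aemeasurable_iUnion_iff]
  exact fun k => (hV.2.2.1 0 (k + 1) (by positivity)).aestronglyMeasurable.aemeasurable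

/-- Integrability over balls of powers of the distance to the centre. -/
theorem exists_setLIntegral_dist'_le {b : ℝ} (hb : 0 ≤ b) (hbQ : b < Qd n) :
    ∃ C > 0, ∀ (h : Hn n) (r : ℝ), 0 < r →
      ∫⁻ g in ball h r, ENNReal.ofReal (dist' h g ^ (-b)) ≤ ENNReal.ofReal (C * r ^ (Qd n - b)) := by
  obtain ⟨v, hv, hvol⟩ := exists_volume_ball n
  refine ⟨dyadicConst (Qd n) b * v, mul_pos (dyadicConst_pos hbQ) hv, fun h r hr => ?_⟩
  exact setLIntegral_rpow_neg_le (continuous_dist'_left h).measurable (dist'_nonneg h) hb hbQ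
    hv.le hr fun s hs _ => (hvol h s hs).le

/-- Composing the kernels of order one gives the kernel of order two: for fixed `w`, the pairs
`(g, w)` with `dist' g w < dist' h g / 4` contribute `O (dist' h w ^ (-(Q - 2)))`. -/
theorem exists_lintegral_kernel_le (n : ℕ) :
    ∃ K > 0, ∀ h w : Hn n,
      ∫⁻ g in {g | dist' g w < dist' h g / 4}, ENNReal.ofReal (dist' h g ^ (-(Qd n - 1))) *
        ENNReal.ofReal (dist' w g ^ (-(Qd n - 1))) ≤
      ENNReal.ofReal (K * dist' h w ^ (-(Qd n - 2))) := by
  have hQ := two_le_Qd n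
  obtain ⟨C, hC, hker⟩ := exists_setLIntegral_dist'_le (n := n) (b := Qd n - 1)
    (by linarith) (by linarith)
  refine ⟨(2 / 5) ^ (-(Qd n - 1)) * C, by positivity, fun h w => ?_⟩
  have hnear : ∀ g, dist' g w < dist' h g / 4 →
      dist' h g ≤ 4 * dist' h w ∧ dist' h w ≤ 5 / 2 * dist' h g := by
    intro g hg
    have h1 := dist'_le h w g
    have h2 := dist'_le h g w
    rw [dist'_comm w g] at h1
    constructor <;> linarith
  rcases (dist'_nonneg h w).eq_or_lt with h0 | h0
  · have hempty : {g | dist' g w < dist' h g / 4} = ∅ := by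
      refine Set.eq_empty_of_forall_notMem fun g hg => ?_
      have hg : dist' g w < dist' h g / 4 := hg
      have h1 := (hnear g hg).1
      have h2 := dist'_nonneg g w
      linarith
    rw [hempty]; simp
  · set D := dist' h w
    have hsub : {g | dist' g w < dist' h g / 4} ⊆ ball w D := by
      intro g hg
      have hg : dist' g w < dist' h g / 4 := hg
      have h1 := (hnear g hg).1
      show dist' w g < D
      rw [dist'_comm]; linarith
    have hm : MeasurableSet {g | dist' g w < dist' h g / 4} := by
      simp only [dist'_comm _ w]
      exact measurableSet_lt (continuous_dist'_left w).measurable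
        ((continuous_dist'_left h).measurable.div_const 4)
    calc _ ≤ ∫⁻ g in {g | dist' g w < dist' h g / 4},
          ENNReal.ofReal ((2 / 5 * D) ^ (-(Qd n - 1))) *
            ENNReal.ofReal (dist' w g ^ (-(Qd n - 1))) := by
          refine setLIntegral_mono' hm fun g hg => ?_
          refine mul_le_mul_left (ENNReal.ofReal_le_ofReal ?_) _
          have h1 := (hnear g hg).2
          have h2 : 2 / 5 * D ≤ dist' h g := by linarith
          exact Real.rpow_le_rpow_of_nonpos (by positivity) h2 (by linarith)
      _ ≤ ∫⁻ g in ball w D, ENNReal.ofReal ((2 / 5 * D) ^ (-(Qd n - 1))) *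
            ENNReal.ofReal (dist' w g ^ (-(Qd n - 1))) := lintegral_mono_set hsub
      _ = ENNReal.ofReal ((2 / 5 * D) ^ (-(Qd n - 1))) *
            ∫⁻ g in ball w D, ENNReal.ofReal (dist' w g ^ (-(Qd n - 1))) :=
          lintegral_const_mul' _ _ ENNReal.ofReal_ne_top
      _ ≤ ENNReal.ofReal ((2 / 5 * D) ^ (-(Qd n - 1))) *
            ENNReal.ofReal (C * D ^ (Qd n - (Qd n - 1))) := by
          gcongr
          exact hker w D h0
      _ = ENNReal.ofReal ((2 / 5) ^ (-(Qd n - 1)) * C * D ^ (-(Qd n - 2))) := by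
          rw [← ENNReal.ofReal_mul (by positivity), Real.mul_rpow (by norm_num) h0.le]
          have e : D ^ (-(Qd n - 2)) = D ^ (-(Qd n - 1)) * D ^ (Qd n - (Qd n - 1)) := by
            rw [← Real.rpow_add h0]; congr 1; ring
          rw [e]; congr 1; ring

theorem exists_lintegral_potential_le (n : ℕ) :
    ∃ K > 0, ∀ (V : Hn n → ℝ), AEMeasurable V → ∀ (h : Hn n) (r : ℝ),
      ∫⁻ g in ball h r, ENNReal.ofReal (dist' h g ^ (-(Qd n - 1))) *
        ∫⁻ w in ball g (dist' h g / 4),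
          ENNReal.ofReal (V w) * ENNReal.ofReal (dist' w g ^ (-(Qd n - 1))) ≤
      ENNReal.ofReal K * ∫⁻ w in ball h (5 / 2 * r),
        ENNReal.ofReal (V w) * ENNReal.ofReal (dist' h w ^ (-(Qd n - 2))) := by
  obtain ⟨K, hK, hker⟩ := exists_lintegral_kernel_le n
  refine ⟨K, hK, fun V hV h r => ?_⟩
  let P : Set (Hn n × Hn n) := {p | dist' h p.1 < r ∧ dist' p.1 p.2 < dist' h p.1 / 4}
  let k : Hn n × Hn n → ENNReal := fun p =>
    ENNReal.ofReal (dist' h p.1 ^ (-(Qd n - 1))) * ENNReal.ofReal (dist' p.2 p.1 ^ (-(Qd n - 1)))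
  have hd1 : Measurable fun p : Hn n × Hn n => dist' h p.1 :=
    (continuous_dist'_left h).measurable.comp measurable_fst
  have hd2 : Measurable fun p : Hn n × Hn n => dist' p.1 p.2 := continuous_dist'.measurable
  have hP : MeasurableSet P :=
    (measurableSet_lt hd1 measurable_const).inter (measurableSet_lt hd2 (hd1.div_const 4))
  have hk : Measurable k := by
    refine (hd1.pow_const _).ennreal_ofReal.mul (Measurable.ennreal_ofReal ?_)
    simp only [dist'_comm _ (Prod.fst _)]
    exact hd2.pow_const _
  have hG : Measurable (P.indicator k) := hk.indicator hP
  have hleft : ∫⁻ g in ball h r, ENNReal.ofReal (dist' h g ^ (-(Qd n - 1))) *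
        ∫⁻ w in ball g (dist' h g / 4),
          ENNReal.ofReal (V w) * ENNReal.ofReal (dist' w g ^ (-(Qd n - 1))) =
      ∫⁻ g, ∫⁻ w, ENNReal.ofReal (V w) * P.indicator k (g, w) := by
    rw [← lintegral_indicator (measurableSet_ball h r)]
    refine lintegral_congr fun g => ?_
    by_cases hg : g ∈ ball h r
    · rw [Set.indicator_of_mem hg, ← lintegral_indicator (measurableSet_ball _ _),
        ← lintegral_const_mul' _ _ ENNReal.ofReal_ne_top]
      refine lintegral_congr fun w => ?_
      by_cases hw : w ∈ ball g (dist' h g / 4)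
      · have hp : (g, w) ∈ P := ⟨hg, hw⟩
        rw [Set.indicator_of_mem hw, Set.indicator_of_mem hp]
        simp only [k]; ring
      · have hp : (g, w) ∉ P := fun hp => hw hp.2
        rw [Set.indicator_of_notMem hw, Set.indicator_of_notMem hp]; simp
    · rw [Set.indicator_of_notMem hg]
      have : ∀ w, P.indicator k (g, w) = 0 := fun w =>
        Set.indicator_of_notMem (fun hp => hg hp.1) _
      simp [this]
  rw [hleft, lintegral_lintegral_swap, ← lintegral_const_mul' _ _ ENNReal.ofReal_ne_top,
    ← lintegral_indicator (measurableSet_ball _ _)]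
  · refine lintegral_mono fun w => ?_
    rw [lintegral_const_mul' _ _ ENNReal.ofReal_ne_top]
    by_cases hw : w ∈ ball h (5 / 2 * r)
    · rw [Set.indicator_of_mem hw, mul_left_comm, ← ENNReal.ofReal_mul hK.le]
      gcongr
      refine le_trans ?_ (hker h w)
      have hm : MeasurableSet {g | dist' g w < dist' h g / 4} := by
        simp only [dist'_comm _ w]
        exact measurableSet_lt (continuous_dist'_left w).measurable
          ((continuous_dist'_left h).measurable.div_const 4)
      rw [← lintegral_indicator hm]
      refine lintegral_mono fun g => ?_
      by_cases hp : (g, w) ∈ P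
      · have hg : g ∈ {g | dist' g w < dist' h g / 4} := hp.2
        rw [Set.indicator_of_mem hp, Set.indicator_of_mem hg]
      · rw [Set.indicator_of_notMem hp]; exact zero_le
    · have : ∀ g, P.indicator k (g, w) = 0 := fun g => by
        refine Set.indicator_of_notMem (fun hp => hw ?_) _
        have h1 : dist' h g < r := hp.1
        have h2 : dist' g w < dist' h g / 4 := hp.2
        have h3 := dist'_le h g w
        show dist' h w < 5 / 2 * r
        linarith
      simp [this]
  · exact (hV.comp_snd.ennreal_ofReal).mul hG.aemeasurable

/-- The potential of order two of `V` over a ball of radius comparable to `rho V h` is bounded. -/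
theorem RevHolder.exists_lintegral_le {V : Hn n → ℝ} {q : ℝ} (hq : 1 < q) (hqQ : Qd n / 2 < q)
    (hV : RevHolder n V q) {a : ℝ} (ha : 0 < a) :
    ∃ C > 0, ∀ h : Hn n, 0 < rho V h →
      ∫⁻ w in ball h (a * rho V h), ENNReal.ofReal (V w) *
        ENNReal.ofReal (dist' h w ^ (-(Qd n - 2))) ≤ ENNReal.ofReal C := by
  obtain ⟨C, hC, hgrowth⟩ := hV.exists_setIntegral_ball_le_rho hq ha
  have hQ := two_le_Qd n
  have hδ : Qd n - 2 < Qd n - Qd n / q := by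
    have : Qd n / q < 2 := by rw [div_lt_iff₀ (by linarith)]; linarith
    linarith
  refine ⟨dyadicConst (Qd n - Qd n / q) (Qd n - 2) * C, mul_pos (dyadicConst_pos hδ) hC,
    fun h hρ => ?_⟩
  have hS : 0 < a * rho V h := by positivity
  have hmeas := hV.aemeasurable.ennreal_ofReal
  have hd : AEMeasurable (fun w => ENNReal.ofReal (dist' h w ^ (-(Qd n - 2)))) :=
    ((continuous_dist'_left h).measurable.pow_const _).ennreal_ofReal.aemeasurable
  have hμ : ∀ s, 0 < s → s ≤ a * rho V h →
      (volume.withDensity fun w => ENNReal.ofReal (V w)) (ball h s) ≤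
        ENNReal.ofReal (C * (a * rho V h) ^ (Qd n / q - 2) * s ^ (Qd n - Qd n / q)) := by
    intro s hs hsa
    rw [withDensity_apply _ (measurableSet_ball h s),
      ← ofReal_integral_eq_lintegral_ofReal (hV.2.2.1 h s hs) (Filter.Eventually.of_forall hV.1)]
    exact ENNReal.ofReal_le_ofReal (hgrowth h hρ s hs hsa)
  have key := setLIntegral_rpow_neg_le (continuous_dist'_left h).measurable (dist'_nonneg h)
    (by linarith) hδ (by positivity) hS hμ
  change ∫⁻ w in ball h (a * rho V h), _ ∂_ ≤ _ at key
  rw [setLIntegral_withDensity_eq_lintegral_mul₀ hmeas hd (measurableSet_ball h _)] at key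
  refine key.trans_eq ?_
  congr 1
  have e : (a * rho V h) ^ (Qd n / q - 2) *
      (a * rho V h) ^ (Qd n - Qd n / q - (Qd n - 2)) = 1 := by
    rw [← Real.rpow_add hS, ← Real.rpow_zero (a * rho V h)]; congr 1; ring
  calc _ = dyadicConst (Qd n - Qd n / q) (Qd n - 2) * C * ((a * rho V h) ^ (Qd n / q - 2) *
      (a * rho V h) ^ (Qd n - Qd n / q - (Qd n - 2))) := by ring
    _ = _ := by rw [e, mul_one]

end Potential

/-- Lemma 9: if the kernels `R^L_j(g,h)` and `R_j(h⁻¹g)` satisfy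
the pointwise difference estimate (a13) on `|h⁻¹g| < A ρ(h)`, then
`∫_{B(h, A ρ(h))} |R^L_j(g,h) - R_j(g,h)| dg ≤ C` for every fixed `A > 0`. -/
theorem riesz_kernel_difference_integral (n : ℕ) (V : Hn n → ℝ) (q₀ : ℝ)
    (hq₀ : Qd n / 2 < q₀) (hq₀' : q₀ < Qd n) (hV : RevHolder n V q₀) (hVne : V ≠ 0)
    (RLK : Hn n → Hn n → ℝ) (Rker : Hn n → ℝ) (A : ℝ) (hA : 0 < A)
    (hdiff : ∃ C > 0, ∀ g h : Hn n, g ≠ h → dist' h g < A * rho V h →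
      |RLK g h - Rker (hmul (hinv h) g)| ≤
        C * dist' h g ^ (-(Qd n - 1)) *
          (∫ w in ball g (dist' h g / 4), V w / dist' w g ^ (Qd n - 1)) +
        C * dist' h g ^ (-(Qd n)) *
          (dist' h g / (A * rho V h)) ^ (2 - Qd n / q₀)) :
    ∃ C > 0, ∀ h : Hn n,
      (∫ g in ball h (A * rho V h), |RLK g h - Rker (hmul (hinv h) g)|) ≤ C := by
  have hQ := two_le_Qd n
  have hq1 : 1 < q₀ := by linarith
  have hδ : Qd n / q₀ < 2 := by rw [div_lt_iff₀ (by linarith)]; linarith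
  have hδ0 : 0 < Qd n / q₀ := by positivity
  obtain ⟨C, hC, hdiff⟩ := hdiff
  obtain ⟨K, hK, hpot⟩ := exists_lintegral_potential_le n
  obtain ⟨C₁, hC₁, hV₁⟩ := hV.exists_lintegral_le hq1 hq₀ (a := 5 / 2 * A) (by positivity)
  obtain ⟨C₂, hC₂, hker⟩ := exists_setLIntegral_dist'_le (n := n) (b := Qd n - (2 - Qd n / q₀))
    (by linarith) (by linarith)
  refine ⟨C * K * C₁ + C * C₂, by positivity, fun h => ?_⟩
  rcases le_or_gt (rho V h) 0 with hρ | hρ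
  · have hempty : ball h (A * rho V h) = ∅ := by
      refine Set.eq_empty_of_forall_notMem fun g hg => ?_
      have hg : dist' h g < A * rho V h := hg
      nlinarith [dist'_nonneg h g]
    rw [hempty]; simp; positivity
  set r := A * rho V h with hr
  have hr0 : 0 < r := by positivity
  have hpoint : ∀ g ∈ ball h r, g ≠ h →
      ENNReal.ofReal ‖|RLK g h - Rker (hmul (hinv h) g)|‖ ≤
        ENNReal.ofReal C * (ENNReal.ofReal (dist' h g ^ (-(Qd n - 1))) *
          ∫⁻ w in ball g (dist' h g / 4),
            ENNReal.ofReal (V w) * ENNReal.ofReal (dist' w g ^ (-(Qd n - 1)))) +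
        ENNReal.ofReal (C * r ^ (-(2 - Qd n / q₀))) *
          ENNReal.ofReal (dist' h g ^ (-(Qd n - (2 - Qd n / q₀)))) := by
    intro g hg hne
    have hd := dist'_nonneg h g
    rw [norm_abs_eq_norm, Real.norm_eq_abs]
    refine (ENNReal.ofReal_le_ofReal (hdiff g h hne hg)).trans ?_
    refine ENNReal.ofReal_add_le.trans (add_le_add ?_ ?_)
    · rw [mul_assoc, ENNReal.ofReal_mul hC.le, ENNReal.ofReal_mul (by positivity)]
      gcongr
      have hle := (le_abs_self _).trans (norm_integral_le_lintegral_norm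
        (μ := volume.restrict (ball g (dist' h g / 4)))
        (fun w => V w / dist' w g ^ (Qd n - 1)))
      refine (ENNReal.ofReal_le_ofReal hle).trans (ENNReal.ofReal_toReal_le.trans ?_)
      refine lintegral_mono fun w => ?_
      have hw := dist'_nonneg w g
      rw [← ENNReal.ofReal_mul (hV.1 w), Real.rpow_neg hw, ← div_eq_mul_inv,
        Real.norm_of_nonneg (div_nonneg (hV.1 w) (by positivity))]
    · rw [← ENNReal.ofReal_mul (by positivity)]
      refine ENNReal.ofReal_le_ofReal ?_
      rcases hd.eq_or_lt with h0 | h0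
      · rw [← h0, Real.zero_rpow (by linarith)]
        simp only [mul_zero, zero_mul]
        positivity
      · rw [Real.div_rpow hd hr0.le, Real.rpow_neg hr0.le]
        have e : dist' h g ^ (-(Qd n - (2 - Qd n / q₀))) =
            dist' h g ^ (-Qd n) * dist' h g ^ (2 - Qd n / q₀) := by
          rw [← Real.rpow_add h0]; congr 1; ring
        rw [e]
        exact le_of_eq (by ring)
  have hae : ∀ᵐ g ∂(volume : Measure (Hn n)), g ≠ h := by
    have : NullSingletonClass (volume : Measure ((Fin n → ℝ) × ℝ)) :=
      Measure.prod.instNullSingletonClass_snd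
    have : NullSingletonClass (volume : Measure (Hn n)) := Measure.prod.instNullSingletonClass_snd
    exact Measure.ae_ne volume h
  have hlint : ∫⁻ g in ball h r, ENNReal.ofReal ‖|RLK g h - Rker (hmul (hinv h) g)|‖ ≤
      ENNReal.ofReal (C * K * C₁ + C * C₂) := by
    have hm2 : Measurable fun g => ENNReal.ofReal (C * r ^ (-(2 - Qd n / q₀))) *
        ENNReal.ofReal (dist' h g ^ (-(Qd n - (2 - Qd n / q₀)))) :=
      ((continuous_dist'_left h).measurable.pow_const _).ennreal_ofReal.const_mul _
    refine (setLIntegral_mono_ae' (measurableSet_ball h r)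
      (hae.mono fun g hne hg => hpoint g hg hne)).trans ?_
    rw [lintegral_add_right _ hm2, lintegral_const_mul' _ _ ENNReal.ofReal_ne_top,
      lintegral_const_mul' _ _ ENNReal.ofReal_ne_top,
      ENNReal.ofReal_add (by positivity) (by positivity)]
    refine add_le_add ?_ ?_
    · rw [mul_assoc, ENNReal.ofReal_mul hC.le, ENNReal.ofReal_mul hK.le]
      gcongr
      refine (hpot V hV.aemeasurable h r).trans ?_
      gcongr
      rw [hr, ← mul_assoc]
      exact hV₁ h hρ
    · refine (mul_le_mul_right (hker h r hr0) _).trans_eq ?_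
      rw [← ENNReal.ofReal_mul (by positivity)]
      congr 1
      have e : r ^ (-(2 - Qd n / q₀)) * r ^ (Qd n - (Qd n - (2 - Qd n / q₀))) = 1 := by
        rw [← Real.rpow_add hr0, ← Real.rpow_zero r]; congr 1; ring
      calc _ = C * C₂ * (r ^ (-(2 - Qd n / q₀)) * r ^ (Qd n - (Qd n - (2 - Qd n / q₀)))) := by
            ring
        _ = C * C₂ := by rw [e, mul_one]
  calc ∫ g in ball h r, |RLK g h - Rker (hmul (hinv h) g)|
      ≤ (∫⁻ g in ball h r, ENNReal.ofReal ‖|RLK g h - Rker (hmul (hinv h) g)|‖).toReal :=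
        (Real.le_norm_self _).trans (norm_integral_le_lintegral_norm _)
    _ ≤ (ENNReal.ofReal (C * K * C₁ + C * C₂)).toReal :=
        ENNReal.toReal_mono ENNReal.ofReal_ne_top hlint
    _ = C * K * C₁ + C * C₂ := ENNReal.toReal_ofReal (by positivity)

end Heisenberg
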